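/- The maximal-lotteries correspondence ML satisfies composition-consistency: for all agendas A', B with A' ∩ B = {b} and A = A' ∪ B, and every profile R on A in which B is a component, ML(R) = ML(R|_{A'}) ×_b ML(R|_B). -/

import Mathlib

open Finset

namespace PSC

/-- `r` is a linear order (complete, transitive, antisymmetric; as a set of pairs) on `A`. -/
def IsLinearOrderOn (A : Finset ℕ) (r : Finset (ℕ × ℕ)) : Prop :=
  r ⊆ A ×ˢ A ∧ (∀ x ∈ A, (x, x) ∈ r) ∧
    (∀ x ∈ A, ∀ y ∈ A, (x, y) ∈ r ∨ (y, x) ∈ r) ∧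
    (∀ x y z : ℕ, (x, y) ∈ r → (y, z) ∈ r → (x, z) ∈ r) ∧
    (∀ x y : ℕ, (x, y) ∈ r → (y, x) ∈ r → x = y)

open Classical in
/-- The set `L(A)` of linear orders on the agenda `A`. -/
noncomputable def linOrders (A : Finset ℕ) : Finset (Finset (ℕ × ℕ)) :=
  (A ×ˢ A).powerset.filter (fun r => IsLinearOrderOn A r)

/-- `R` is a (fractional) preference profile on the agenda `A`. -/
def IsProfile (A : Finset ℕ) (R : Finset (ℕ × ℕ) → ℚ) : Prop :=
  (∀ r, r ∉ linOrders A → R r = 0) ∧ (∀ r, 0 ≤ R r) ∧ (∑ r ∈ linOrders A, R r) = 1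

open Classical in
/-- `R(x,y)`: the total weight of orders ranking `x` strictly above `y`. -/
noncomputable def pref (A : Finset ℕ) (R : Finset (ℕ × ℕ) → ℚ) (x y : ℕ) : ℚ :=
  ∑ r ∈ (linOrders A).filter (fun r => (x, y) ∈ r ∧ (y, x) ∉ r), R r

/-- The majority margin `M_R(x,y) = R(x,y) - R(y,x)`. -/
noncomputable def margin (A : Finset ℕ) (R : Finset (ℕ × ℕ) → ℚ) (x y : ℕ) : ℚ :=
  pref A R x y - pref A R y x

/-- `p` is a lottery on `A`. -/
def IsLottery (A : Finset ℕ) (p : ℕ → ℚ) : Prop :=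
  (∀ x, x ∉ A → p x = 0) ∧ (∀ x, 0 ≤ p x) ∧ (∑ x ∈ A, p x) = 1

/-- `Δ(A)`, the set of lotteries on `A`. -/
def lotteries (A : Finset ℕ) : Set (ℕ → ℚ) := {p | IsLottery A p}

/-- 1-norm distance between two profiles on `A`. -/
noncomputable def profileDist (A : Finset ℕ) (R R' : Finset (ℕ × ℕ) → ℚ) : ℚ :=
  ∑ r ∈ linOrders A, |R r - R' r|

/-- 1-norm distance between two lotteries on `A`. -/
noncomputable def lotteryDist (A : Finset ℕ) (p q : ℕ → ℚ) : ℚ :=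
  ∑ x ∈ A, |p x - q x|

/-- Restriction of an order to `B`. -/
def restrictOrder (B : Finset ℕ) (r : Finset (ℕ × ℕ)) : Finset (ℕ × ℕ) := r ∩ B ×ˢ B

open Classical in
/-- The restriction `R|_B` of a profile on `A` to `B`. -/
noncomputable def restrictProfile (A B : Finset ℕ) (R : Finset (ℕ × ℕ) → ℚ) :
    Finset (ℕ × ℕ) → ℚ :=
  fun s => ∑ r ∈ (linOrders A).filter (fun r => restrictOrder B r = s), R r

/-- `B` is a component in the profile `R` on `A`. -/
def IsComponent (A B : Finset ℕ) (R : Finset (ℕ × ℕ) → ℚ) : Prop :=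
  B ⊆ A ∧ ∀ a ∈ A \ B, ∀ b ∈ B, ∀ b' ∈ B, ∀ r ∈ linOrders A, 0 < R r →
    ((a, b) ∈ r ↔ (a, b') ∈ r)

/-- The composed lottery `p ×_b q` (where `B` is the component). -/
def compLottery (B : Finset ℕ) (b : ℕ) (p q : ℕ → ℚ) : ℕ → ℚ :=
  fun x => if x ∈ B then p b * q x else p x

/-- `X ×_b Y` for sets of lotteries. -/
def compSet (B : Finset ℕ) (b : ℕ) (X Y : Set (ℕ → ℚ)) : Set (ℕ → ℚ) :=
  {pr | ∃ p ∈ X, ∃ q ∈ Y, pr = compLottery B b p q}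

/-- A probabilistic social choice function: to every (finite nonempty) agenda `A ⊆ ℕ` and
every profile on `A` it assigns a nonempty convex set of lotteries on `A`; it is upper
hemi-continuous and satisfies unanimity and decisiveness. -/
structure PSCF where
  choice : Finset ℕ → (Finset (ℕ × ℕ) → ℚ) → Set (ℕ → ℚ)
  nonempty : ∀ A : Finset ℕ, A.Nonempty → ∀ R, IsProfile A R → (choice A R).Nonempty
  subset_lotteries : ∀ A : Finset ℕ, A.Nonempty → ∀ R, IsProfile A R →
    choice A R ⊆ lotteries A
  convex : ∀ A : Finset ℕ, A.Nonempty → ∀ R, IsProfile A R →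
    ∀ p ∈ choice A R, ∀ q ∈ choice A R, ∀ t : ℚ, 0 ≤ t → t ≤ 1 →
      (fun x => t * p x + (1 - t) * q x) ∈ choice A R
  continuity : ∀ A : Finset ℕ, A.Nonempty → ∀ R, IsProfile A R → ∀ ε : ℚ, 0 < ε →
    ∃ δ : ℚ, 0 < δ ∧ ∀ R', IsProfile A R' → profileDist A R R' < δ →
      ∀ p ∈ choice A R', ∃ q ∈ choice A R, lotteryDist A p q < ε
  unanimity : ∀ x y : ℕ, ∀ R, IsProfile {x, y} R → pref {x, y} R x y = 1 →
    choice {x, y} R = {fun z => if z = x then 1 else 0}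
  decisive : ∀ A : Finset ℕ, A.Nonempty → ∀ R, IsProfile A R → ∀ ε : ℚ, 0 < ε →
    ∃ R', IsProfile A R' ∧ profileDist A R R' < ε ∧ ∃ p, choice A R' = {p}

/-- Population-consistency. -/
def PopulationConsistent (f : PSCF) : Prop :=
  ∀ A : Finset ℕ, A.Nonempty → ∀ R' R'', IsProfile A R' → IsProfile A R'' →
    ∀ l : ℚ, 0 ≤ l → l ≤ 1 →
      f.choice A R' ∩ f.choice A R'' ⊆ f.choice A (fun r => l * R' r + (1 - l) * R'' r)

/-- Composition-consistency. -/
def CompositionConsistent (f : PSCF) : Prop :=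
  ∀ A' B : Finset ℕ, ∀ b : ℕ, A' ∩ B = {b} →
    ∀ R, IsProfile (A' ∪ B) R → IsComponent (A' ∪ B) B R →
      f.choice (A' ∪ B) R =
        compSet B b (f.choice A' (restrictProfile (A' ∪ B) A' R))
          (f.choice B (restrictProfile (A' ∪ B) B R))

/-- The maximal-lotteries correspondence. -/
noncomputable def ML (A : Finset ℕ) (R : Finset (ℕ × ℕ) → ℚ) : Set (ℕ → ℚ) :=
  {p | IsLottery A p ∧ ∀ q, IsLottery A q →
    0 ≤ ∑ x ∈ A, ∑ y ∈ A, p x * margin A R x y * q y}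

/-- The uniform profile `uni(L(A))` on `A`. -/
noncomputable def uniProfile (A : Finset ℕ) : Finset (ℕ × ℕ) → ℚ :=
  fun r => if r ∈ linOrders A then ((Nat.factorial A.card : ℕ) : ℚ)⁻¹ else 0

/-- The uniform lottery `uni(A)` on `A`. -/
def uniLottery (A : Finset ℕ) : ℕ → ℚ :=
  fun x => if x ∈ A then (A.card : ℚ)⁻¹ else 0

/-- The degenerate lottery on `x`. -/
def degLottery (x : ℕ) : ℕ → ℚ := fun z => if z = x then 1 else 0

/-- `x` is a (weak) Condorcet winner in `R`. -/
def IsCondorcetWinner (A : Finset ℕ) (R : Finset (ℕ × ℕ) → ℚ) (x : ℕ) : Prop :=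
  x ∈ A ∧ ∀ y ∈ A, 0 ≤ margin A R x y

/-- `R` is regular on `A'`. -/
def Regular (A A' : Finset ℕ) (R : Finset (ℕ × ℕ) → ℚ) : Prop :=
  ∀ x ∈ A', (∑ y ∈ A', margin A R x y) = 0

/-- `R` is strongly regular on `A'`. -/
def StronglyRegular (A A' : Finset ℕ) (R : Finset (ℕ × ℕ) → ℚ) : Prop :=
  ∀ x ∈ A', ∀ y ∈ A', margin A R x y = 0

/-- Image of an order under a renaming `π`. -/
def mapOrder (π : ℕ → ℕ) (r : Finset (ℕ × ℕ)) : Finset (ℕ × ℕ) :=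
  r.image (fun xy => (π xy.1, π xy.2))

open Classical in
/-- The image `π(R)` of a profile on `A` under a renaming `π`. -/
noncomputable def mapProfile (π : ℕ → ℕ) (A : Finset ℕ) (R : Finset (ℕ × ℕ) → ℚ) :
    Finset (ℕ × ℕ) → ℚ :=
  fun s => ∑ r ∈ (linOrders A).filter (fun r => mapOrder π r = s), R r

open Classical in
/-- The image `π(p)` of a lottery on `A` under a renaming `π`. -/
noncomputable def mapLottery (π : ℕ → ℕ) (A : Finset ℕ) (p : ℕ → ℚ) : ℕ → ℚ :=
  fun y => ∑ x ∈ A.filter (fun x => π x = y), p x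

/-- The bound `ε_n = (4^n · ∏_{k=1}^n k!)⁻¹`. -/
noncomputable def epsN (n : ℕ) : ℚ :=
  (((4 ^ n * ∏ k ∈ Finset.Icc 1 n, Nat.factorial k : ℕ) : ℚ))⁻¹

theorem farkas_aux {V ι : Type*} [AddCommGroup V] [Module ℚ V] [DecidableEq ι] (S : Finset ι) :
    ∀ (a : ι → V →ₗ[ℚ] ℚ) (c : V →ₗ[ℚ] ℚ),
      (∀ x, (∀ i ∈ S, a i x ≤ 0) → c x ≤ 0) →
      ∃ u : ι → ℚ, (∀ i ∈ S, 0 ≤ u i) ∧ ∀ x, c x = ∑ i ∈ S, u i * a i x := by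
  induction S using Finset.induction_on with
  | empty =>
    intro a c h
    refine ⟨fun _ => 0, by simp, fun x => ?_⟩
    have h1 := h x (by simp)
    have h2 := h (-x) (by simp)
    rw [map_neg] at h2
    simp only [Finset.sum_empty]
    linarith
  | insert n S hn ih =>
    intro a c h
    by_cases hc : ∀ x, (∀ i ∈ S, a i x ≤ 0) → c x ≤ 0
    · obtain ⟨u, hu, hx⟩ := ih a c hc
      refine ⟨fun i => if i = n then 0 else u i, ?_, fun x => ?_⟩
      · intro i hi
        by_cases hin : i = n
        · simp [hin]
        · simp only [hin, if_false]
          exact hu i ((Finset.mem_insert.1 hi).resolve_left hin)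
      · rw [Finset.sum_insert hn, hx x]
        simp only [if_true, zero_mul, zero_add]
        refine Finset.sum_congr rfl fun i hi => ?_
        have : i ≠ n := fun e => hn (e ▸ hi)
        simp [this]
    · push Not at hc
      obtain ⟨x0, h0, hc0⟩ := hc
      have hpos : 0 < a n x0 := by
        by_contra hneg
        have := h x0 (by
          intro i hi
          rcases Finset.mem_insert.1 hi with rfl | hi
          · exact not_lt.1 hneg
          · exact h0 i hi)
        linarith
      set t := a n x0 with ht
      obtain ⟨u, hu, hx⟩ := ih (fun i => a i - (a i x0 / t) • a n) (c - (c x0 / t) • a n) (by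
        intro x hx
        have := h (x - (a n x / t) • x0) (by
          intro i hi
          rcases Finset.mem_insert.1 hi with rfl | hi
          · rw [map_sub, map_smul, smul_eq_mul, ← ht]
            field_simp
            simp
          · have := hx i hi
            simp only [LinearMap.sub_apply, LinearMap.smul_apply, smul_eq_mul] at this
            rw [map_sub, map_smul, smul_eq_mul]
            have e : a n x / t * a i x0 = a i x0 / t * a n x := by ring
            rw [e]; exact this)
        rw [map_sub, map_smul, smul_eq_mul] at this
        simp only [LinearMap.sub_apply, LinearMap.smul_apply, smul_eq_mul]
        have e : a n x / t * c x0 = c x0 / t * a n x := by ring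
        rw [← e]; exact this)
      refine ⟨fun i => if i = n then c x0 / t - ∑ j ∈ S, u j * (a j x0 / t) else u i, ?_,
        fun x => ?_⟩
      · intro i hi
        by_cases hin : i = n
        · simp only [hin, if_true]
          have h1 : 0 ≤ c x0 / t := (div_pos hc0 hpos).le
          have h2 : ∑ j ∈ S, u j * (a j x0 / t) ≤ 0 :=
            Finset.sum_nonpos fun j hj =>
              mul_nonpos_of_nonneg_of_nonpos (hu j hj)
                (div_nonpos_of_nonpos_of_nonneg (h0 j hj) hpos.le)
          linarith
        · simp only [hin, if_false]
          exact hu i ((Finset.mem_insert.1 hi).resolve_left hin)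
      · have e1 : ∑ i ∈ S, (if i = n then c x0 / t - ∑ j ∈ S, u j * (a j x0 / t) else u i) * a i x
            = ∑ i ∈ S, u i * a i x := by
          refine Finset.sum_congr rfl fun i hi => ?_
          have : i ≠ n := fun e => hn (e ▸ hi)
          simp [this]
        rw [Finset.sum_insert hn, e1]
        have := hx x
        simp only [LinearMap.sub_apply, LinearMap.smul_apply, smul_eq_mul, mul_sub,
          Finset.sum_sub_distrib] at this
        simp only [if_true, sub_mul, Finset.sum_mul]
        have e2 : ∑ i ∈ S, u i * (a i x0 / t) * a n x = ∑ i ∈ S, u i * (a i x0 / t * a n x) :=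
          Finset.sum_congr rfl fun i _ => by ring
        rw [e2]
        linarith

/-- Maximality with respect to pure deviations. -/
def MLm (A : Finset ℕ) (M : ℕ → ℕ → ℚ) (p : ℕ → ℚ) : Prop :=
  IsLottery A p ∧ ∀ y ∈ A, 0 ≤ ∑ x ∈ A, p x * M x y

theorem MLm_exists (B : Finset ℕ) (hB : B.Nonempty) (M : ℕ → ℕ → ℚ)
    (hM : ∀ x y, M x y = - M y x) : ∃ q, MLm B M q := by
  classical
  by_contra hno
  let a : ℕ ⊕ ℕ → (ℕ → ℚ) →ₗ[ℚ] ℚ := fun i =>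
    match i with
    | Sum.inl y => -∑ x ∈ B, M x y • LinearMap.proj x
    | Sum.inr x => -LinearMap.proj x
  let c : (ℕ → ℚ) →ₗ[ℚ] ℚ := ∑ x ∈ B, LinearMap.proj x
  have hl : ∀ y p, a (Sum.inl y) p = -∑ x ∈ B, p x * M x y := by
    intro y p
    simp [a, LinearMap.sum_apply, mul_comm]
  have hr : ∀ y p, a (Sum.inr y) p = - p y := by
    intro y p; simp [a]
  have hcc : ∀ p, c p = ∑ x ∈ B, p x := by
    intro p; simp [c, LinearMap.sum_apply]
  have key : ∀ p, (∀ i ∈ B.disjSum B, a i p ≤ 0) → c p ≤ 0 := by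
    intro p hp
    by_contra hpos
    push Not at hpos
    apply hno
    rw [hcc] at hpos
    set s := ∑ x ∈ B, p x with hs
    have h1 : ∀ y ∈ B, 0 ≤ ∑ x ∈ B, p x * M x y := fun y hy => by
      have := hp (Sum.inl y) (by simpa using hy)
      rw [hl] at this; linarith
    have h2 : ∀ y ∈ B, 0 ≤ p y := fun y hy => by
      have := hp (Sum.inr y) (by simpa using hy)
      rw [hr] at this; linarith
    refine ⟨fun x => if x ∈ B then p x / s else 0, ⟨?_, ?_, ?_⟩, ?_⟩
    · intro x hx; simp [hx]
    · intro x
      by_cases hx : x ∈ B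
      · simp only [hx, if_true]; exact div_nonneg (h2 x hx) hpos.le
      · simp [hx]
    · rw [Finset.sum_congr rfl (fun x hx => if_pos hx), ← Finset.sum_div]
      exact div_self hpos.ne'
    · intro y hy
      have : ∑ x ∈ B, (if x ∈ B then p x / s else 0) * M x y = (∑ x ∈ B, p x * M x y) / s := by
        rw [Finset.sum_div]
        refine Finset.sum_congr rfl fun x hx => ?_
        rw [if_pos hx]; ring
      rw [this]
      exact div_nonneg (h1 y hy) hpos.le
  obtain ⟨u, hu, hx⟩ := farkas_aux _ a c key
  have hu1 : ∀ y ∈ B, 0 ≤ u (Sum.inl y) := fun y hy => hu _ (by simpa using hy)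
  have hu2 : ∀ y ∈ B, 0 ≤ u (Sum.inr y) := fun y hy => hu _ (by simpa using hy)
  have hz : ∀ z ∈ B, ∑ y ∈ B, u (Sum.inl y) * M y z = 1 + u (Sum.inr z) := by
    intro z hz
    have := hx (Pi.single z 1)
    rw [hcc, Finset.sum_disjSum] at this
    simp only [hl, hr, Pi.single_apply, ite_mul, one_mul, zero_mul, Finset.sum_ite_eq',
      if_pos hz] at this
    have e1 : ∑ y ∈ B, u (Sum.inl y) * -M z y = ∑ y ∈ B, u (Sum.inl y) * M y z :=
      Finset.sum_congr rfl fun y _ => by rw [hM y z]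
    have e2 : ∑ x ∈ B, u (Sum.inr x) * -(if x = z then (1:ℚ) else 0) = - u (Sum.inr z) := by
      simp [hz]
    rw [e1, e2] at this
    linarith
  have hcu := key (fun y => u (Sum.inl y)) (by
    intro i hi
    rcases Finset.mem_disjSum.1 hi with ⟨y, hy, rfl⟩ | ⟨y, hy, rfl⟩
    · rw [hl, hz y hy]; have := hu2 y hy; linarith
    · rw [hr]; have := hu1 y hy; linarith)
  rw [hcc] at hcu
  have h0 := (Finset.sum_eq_zero_iff_of_nonneg hu1).1 (le_antisymm hcu (Finset.sum_nonneg hu1))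
  obtain ⟨z, hzB⟩ := hB
  have h3 := hz z hzB
  rw [Finset.sum_eq_zero (fun y hy => by rw [h0 y hy, zero_mul])] at h3
  have := hu2 z hzB
  linarith

theorem skew_sum (A : Finset ℕ) (M : ℕ → ℕ → ℚ) (hM : ∀ x y, M x y = - M y x) (p : ℕ → ℚ) :
    ∑ y ∈ A, p y * ∑ x ∈ A, p x * M x y = 0 := by
  have h : ∑ y ∈ A, p y * ∑ x ∈ A, p x * M x y = - ∑ y ∈ A, p y * ∑ x ∈ A, p x * M x y := by
    conv_lhs => simp only [Finset.mul_sum]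
    rw [Finset.sum_comm, ← Finset.sum_neg_distrib]
    refine Finset.sum_congr rfl fun x _ => ?_
    rw [Finset.mul_sum, ← Finset.sum_neg_distrib]
    refine Finset.sum_congr rfl fun y _ => ?_
    rw [hM x y]; ring
  linarith

theorem mem_ML_iff (A : Finset ℕ) (R : Finset (ℕ × ℕ) → ℚ) (M : ℕ → ℕ → ℚ)
    (hM : ∀ x ∈ A, ∀ y ∈ A, margin A R x y = M x y) (p : ℕ → ℚ) : p ∈ ML A R ↔ MLm A M p := by
  have e : ∀ q : ℕ → ℚ, ∑ x ∈ A, ∑ y ∈ A, p x * margin A R x y * q y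
      = ∑ y ∈ A, (∑ x ∈ A, p x * M x y) * q y := by
    intro q
    rw [Finset.sum_comm]
    refine Finset.sum_congr rfl fun y hy => ?_
    rw [Finset.sum_mul]
    exact Finset.sum_congr rfl fun x hx => by rw [hM x hx y hy]
  constructor
  · rintro ⟨hp, h⟩
    refine ⟨hp, fun y hy => ?_⟩
    have := h (fun z => if z = y then 1 else 0) ⟨?_, ?_, ?_⟩
    · rw [e] at this
      simpa [hy] using this
    · intro x hx
      have : x ≠ y := fun h => hx (h ▸ hy)
      simp [this]
    · intro x; dsimp only; split_ifs <;> norm_num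
    · simp [hy]
  · rintro ⟨hp, h⟩
    refine ⟨hp, fun q hq => ?_⟩
    rw [e]
    exact Finset.sum_nonneg fun y hy => mul_nonneg (h y hy) (hq.2.1 y)

theorem MLm_comp (C B : Finset ℕ) (b : ℕ) (hb : b ∈ B) (hd : Disjoint C B) (M : ℕ → ℕ → ℚ)
    (hM : ∀ x y, M x y = - M y x) (hc : ∀ x ∈ C, ∀ y ∈ B, M x y = M x b) (r : ℕ → ℚ) :
    MLm (C ∪ B) M r ↔ ∃ p, MLm (insert b C) M p ∧ ∃ q, MLm B M q ∧ r = compLottery B b p q := by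
  have hbC : b ∉ C := fun h => Finset.disjoint_left.1 hd h hb
  have hCB : ∀ x ∈ C, x ∉ B := fun x hx h => Finset.disjoint_left.1 hd hx h
  have hbb : M b b = 0 := by have := hM b b; linarith
  have hc' : ∀ x ∈ C, ∀ y ∈ B, M y x = M b x := fun x hx y hy => by
    rw [hM y x, hM b x, hc x hx y hy]
  constructor
  · rintro ⟨⟨hr0, hrn, hr1⟩, hr⟩
    rw [Finset.sum_union hd] at hr1
    have hT : ∀ y ∈ B, ∑ x ∈ C, r x * M x y = ∑ x ∈ C, r x * M x b := fun y hy =>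
      Finset.sum_congr rfl fun x hx => by rw [hc x hx y hy]
    have hzero := skew_sum (C ∪ B) M hM r
    have hz := (Finset.sum_eq_zero_iff_of_nonneg
      (fun y hy => mul_nonneg (hrn y) (hr y hy))).1 hzero
    set s := ∑ x ∈ B, r x with hs
    set T := ∑ x ∈ C, r x * M x b with hTd
    have hs0 : 0 ≤ s := Finset.sum_nonneg fun x _ => hrn x
    have hsT : s * T = 0 := by
      have h1 : ∑ y ∈ B, r y * ∑ x ∈ C ∪ B, r x * M x y = 0 :=
        Finset.sum_eq_zero fun y hy => hz y (Finset.mem_union_right _ hy)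
      have h2 := skew_sum B M hM r
      have h3 : ∑ y ∈ B, r y * ∑ x ∈ C ∪ B, r x * M x y
          = s * T + ∑ y ∈ B, r y * ∑ x ∈ B, r x * M x y := by
        rw [hs, Finset.sum_mul, ← Finset.sum_add_distrib]
        refine Finset.sum_congr rfl fun y hy => ?_
        rw [Finset.sum_union hd, hT y hy]; ring
      linarith
    have hrB : s = 0 → ∀ x ∈ B, r x = 0 := fun h =>
      (Finset.sum_eq_zero_iff_of_nonneg (fun x _ => hrn x)).1 h
    have hT0 : 0 ≤ T := by
      rcases mul_eq_zero.1 hsT with h | h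
      · have := hr b (Finset.mem_union_right _ hb)
        rw [Finset.sum_union hd, ← hTd,
          Finset.sum_eq_zero (s := B) (fun x hx => by rw [hrB h x hx, zero_mul])] at this
        linarith
      · rw [h]
    have hpC : ∀ x ∈ C, (if x = b then s else if x ∈ C then r x else 0) = r x := by
      intro x hx
      have : x ≠ b := fun h => hbC (h ▸ hx)
      simp [this, hx]
    have hq : ∃ q, MLm B M q ∧ ∀ x ∈ B, r x = s * q x := by
      by_cases h : s = 0
      · obtain ⟨q, hq⟩ := MLm_exists B ⟨b, hb⟩ M hM
        exact ⟨q, hq, fun x hx => by rw [hrB h x hx, h, zero_mul]⟩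
      · have hTz : T = 0 := (mul_eq_zero.1 hsT).resolve_left h
        refine ⟨fun x => if x ∈ B then r x / s else 0, ⟨⟨?_, ?_, ?_⟩, ?_⟩, ?_⟩
        · intro x hx; simp [hx]
        · intro x
          dsimp only
          split_ifs
          · exact div_nonneg (hrn x) hs0
          · exact le_rfl
        · rw [Finset.sum_congr rfl (fun x hx => if_pos hx), ← Finset.sum_div]
          exact div_self h
        · intro y hy
          have h1 : ∑ x ∈ B, (if x ∈ B then r x / s else 0) * M x y
              = (∑ x ∈ B, r x * M x y) / s := by
            rw [Finset.sum_div]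
            refine Finset.sum_congr rfl fun x hx => ?_
            rw [if_pos hx]; ring
          rw [h1]
          refine div_nonneg ?_ hs0
          have := hr y (Finset.mem_union_right _ hy)
          rw [Finset.sum_union hd, hT y hy, hTz, zero_add] at this
          exact this
        · intro x hx
          simp only [if_pos hx]; field_simp
    obtain ⟨q, hq, hrq⟩ := hq
    refine ⟨fun x => if x = b then s else if x ∈ C then r x else 0, ⟨⟨?_, ?_, ?_⟩, ?_⟩, q, hq, ?_⟩
    · intro x hx
      rw [Finset.mem_insert, not_or] at hx
      simp [hx.1, hx.2]
    · intro x
      dsimp only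
      split_ifs
      · exact hs0
      · exact hrn x
      · exact le_rfl
    · rw [Finset.sum_insert hbC, Finset.sum_congr rfl hpC, if_pos rfl]
      linarith
    · intro y hy
      beta_reduce
      rw [Finset.sum_insert hbC, if_pos rfl,
        Finset.sum_congr rfl (fun x hx => by rw [hpC x hx] : ∀ x ∈ C, _ = r x * M x y)]
      rcases Finset.mem_insert.1 hy with rfl | hy
      · rw [hbb, mul_zero, zero_add]; exact hT0
      · have := hr y (Finset.mem_union_left _ hy)
        rw [Finset.sum_union hd, Finset.sum_congr rfl
          (fun x hx => by rw [hc' y hy x hx] : ∀ x ∈ B, r x * M x y = r x * M b y),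
          ← Finset.sum_mul] at this
        linarith
    · funext x
      unfold compLottery
      by_cases hx : x ∈ B
      · simp only [hx, if_true]
        exact hrq x hx
      · have : x ≠ b := fun h => hx (h ▸ hb)
        simp only [hx, if_false, this]
        by_cases hxC : x ∈ C
        · simp [hxC]
        · simp only [hxC, if_false]
          exact hr0 x (by simp [hx, hxC])
  · rintro ⟨p, ⟨⟨hp0, hpn, hp1⟩, hp⟩, q, ⟨⟨hq0, hqn, hq1⟩, hq⟩, rfl⟩
    have hB : ∀ x ∈ B, compLottery B b p q x = p b * q x := fun x hx => by
      simp [compLottery, hx]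
    have hC : ∀ x ∈ C, compLottery B b p q x = p x := fun x hx => by
      simp [compLottery, hCB x hx]
    rw [Finset.sum_insert hbC] at hp1
    refine ⟨⟨?_, ?_, ?_⟩, ?_⟩
    · intro x hx
      rw [Finset.mem_union, not_or] at hx
      have : x ≠ b := fun h => hx.2 (h ▸ hb)
      simp only [compLottery, hx.2, if_false]
      exact hp0 x (by simp [this, hx.1])
    · intro x
      unfold compLottery
      split_ifs
      · exact mul_nonneg (hpn b) (hqn x)
      · exact hpn x
    · rw [Finset.sum_union hd, Finset.sum_congr rfl hB, Finset.sum_congr rfl hC,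
        ← Finset.mul_sum, hq1]
      linarith
    · intro y hy
      rw [Finset.sum_union hd,
        Finset.sum_congr rfl (fun x hx => by rw [hC x hx] : ∀ x ∈ C, _ = p x * M x y),
        Finset.sum_congr rfl (fun x hx => by rw [hB x hx, mul_assoc] :
          ∀ x ∈ B, _ = p b * (q x * M x y)), ← Finset.mul_sum]
      rcases Finset.mem_union.1 hy with hy | hy
      · have := hp y (Finset.mem_insert_of_mem hy)
        rw [Finset.sum_insert hbC] at this
        rw [Finset.sum_congr rfl
          (fun x hx => by rw [hc' y hy x hx] : ∀ x ∈ B, q x * M x y = q x * M b y),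
          ← Finset.sum_mul, hq1]
        linarith
      · have := hp b (Finset.mem_insert_self _ _)
        rw [Finset.sum_insert hbC, hbb, mul_zero, zero_add] at this
        rw [Finset.sum_congr rfl
          (fun x hx => by rw [hc x hx y hy] : ∀ x ∈ C, p x * M x y = p x * M x b)]
        exact add_nonneg this (mul_nonneg (hpn b) (hq y hy))

theorem mem_linOrders {A : Finset ℕ} {r : Finset (ℕ × ℕ)} :
    r ∈ linOrders A ↔ IsLinearOrderOn A r := by
  classical
  unfold linOrders
  rw [Finset.mem_filter, Finset.mem_powerset]
  exact ⟨fun h => h.2, fun h => ⟨h.1, h⟩⟩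

theorem mem_restrictOrder {C : Finset ℕ} {r : Finset (ℕ × ℕ)} {x y : ℕ} :
    (x, y) ∈ restrictOrder C r ↔ (x, y) ∈ r ∧ x ∈ C ∧ y ∈ C := by
  simp [restrictOrder]

theorem restrict_mem {A C : Finset ℕ} (hCA : C ⊆ A) {r : Finset (ℕ × ℕ)}
    (hr : r ∈ linOrders A) : restrictOrder C r ∈ linOrders C := by
  rw [mem_linOrders] at hr ⊢
  obtain ⟨_, h2, h3, h4, h5⟩ := hr
  refine ⟨Finset.inter_subset_right, ?_, ?_, ?_, ?_⟩
  · intro x hx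
    exact mem_restrictOrder.2 ⟨h2 x (hCA hx), hx, hx⟩
  · intro x hx y hy
    rcases h3 x (hCA hx) y (hCA hy) with h | h
    · exact Or.inl (mem_restrictOrder.2 ⟨h, hx, hy⟩)
    · exact Or.inr (mem_restrictOrder.2 ⟨h, hy, hx⟩)
  · intro x y z h h'
    rw [mem_restrictOrder] at *
    exact ⟨h4 x y z h.1 h'.1, h.2.1, h'.2.2⟩
  · intro x y h h'
    rw [mem_restrictOrder] at *
    exact h5 x y h.1 h'.1

theorem pref_restrict {A C : Finset ℕ} (hCA : C ⊆ A) (R : Finset (ℕ × ℕ) → ℚ) {x y : ℕ}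
    (hx : x ∈ C) (hy : y ∈ C) : pref C (restrictProfile A C R) x y = pref A R x y := by
  classical
  unfold pref restrictProfile
  have h := Finset.sum_fiberwise_of_maps_to
    (s := (linOrders A).filter (fun r => (x, y) ∈ r ∧ (y, x) ∉ r))
    (t := (linOrders C).filter (fun r => (x, y) ∈ r ∧ (y, x) ∉ r))
    (g := restrictOrder C) (by
      intro r hr
      rw [Finset.mem_filter] at hr ⊢
      refine ⟨restrict_mem hCA hr.1, ?_⟩
      simp only [mem_restrictOrder, hx, hy, and_true]
      exact hr.2) R
  refine Eq.trans ?_ (h.trans ?_)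
  · refine Finset.sum_congr (by ext; simp) fun s hs => Finset.sum_congr ?_ fun _ _ => rfl
    ext r
    simp only [Finset.mem_filter] at hs ⊢
    constructor
    · rintro ⟨h1, rfl⟩
      simp only [mem_restrictOrder, hx, hy, and_true] at hs
      exact ⟨⟨h1, hs.2⟩, rfl⟩
    · rintro ⟨⟨h1, _⟩, h2⟩
      exact ⟨h1, h2⟩
  · exact Finset.sum_congr (by ext; simp) fun _ _ => rfl

theorem pref_comp {A B : Finset ℕ} (R : Finset (ℕ × ℕ) → ℚ) (hR : IsProfile A R)
    (hcomp : IsComponent A B R) {a b b' : ℕ} (ha : a ∈ A) (haB : a ∉ B) (hb : b ∈ B)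
    (hb' : b' ∈ B) : pref A R a b = pref A R a b' ∧ pref A R b a = pref A R b' a := by
  classical
  have hab : ∀ z ∈ B, ∀ r ∈ linOrders A, ((z, a) ∈ r ↔ (a, z) ∉ r) := by
    intro z hz r hr
    rw [mem_linOrders] at hr
    have hne : a ≠ z := fun h => haB (h ▸ hz)
    constructor
    · intro h h'
      exact hne (hr.2.2.2.2 _ _ h' h)
    · intro h
      exact (hr.2.2.1 a ha z (hcomp.1 hz)).resolve_left h
  have key : ∀ r ∈ linOrders A, R r ≠ 0 → ((a, b) ∈ r ↔ (a, b') ∈ r) := fun r hr h0 =>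
    hcomp.2 a (Finset.mem_sdiff.2 ⟨ha, haB⟩) b hb b' hb' r hr (lt_of_le_of_ne (hR.2.1 r) h0.symm)
  unfold pref
  simp only [Finset.sum_filter]
  constructor
  · refine Finset.sum_congr rfl fun r hr => ?_
    by_cases h0 : R r = 0
    · simp [h0]
    · simp only [hab b hb r hr, hab b' hb' r hr, key r hr h0]
  · refine Finset.sum_congr rfl fun r hr => ?_
    by_cases h0 : R r = 0
    · simp [h0]
    · simp only [hab b hb r hr, hab b' hb' r hr, key r hr h0]

/-- `ML` satisfies composition-consistency. -/
theorem ml_compositionConsistent (A' B : Finset ℕ) (b : ℕ) (hb : A' ∩ B = {b})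
    (R : Finset (ℕ × ℕ) → ℚ) (hR : IsProfile (A' ∪ B) R)
    (hcomp : IsComponent (A' ∪ B) B R) :
    ML (A' ∪ B) R =
      compSet B b (ML A' (restrictProfile (A' ∪ B) A' R))
        (ML B (restrictProfile (A' ∪ B) B R)) := by
  have hbm : b ∈ A' ∧ b ∈ B := by
    have : b ∈ A' ∩ B := by rw [hb]; simp
    exact Finset.mem_inter.1 this
  have hd : Disjoint (A'.erase b) B := by
    rw [Finset.disjoint_left]
    intro x hx hxB
    have h1 : x ∈ A' ∩ B := Finset.mem_inter.2 ⟨Finset.mem_of_mem_erase hx, hxB⟩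
    rw [hb, Finset.mem_singleton] at h1
    exact Finset.ne_of_mem_erase hx h1
  have hins : insert b (A'.erase b) = A' := Finset.insert_erase hbm.1
  have hun : A'.erase b ∪ B = A' ∪ B := by
    ext x
    simp only [Finset.mem_union, Finset.mem_erase]
    by_cases hx : x = b
    · subst hx; simp [hbm.2]
    · simp [hx]
  have hmr : ∀ C ⊆ A' ∪ B, ∀ x ∈ C, ∀ y ∈ C,
      margin C (restrictProfile (A' ∪ B) C R) x y = margin (A' ∪ B) R x y := by
    intro C hC x hx y hy
    unfold margin
    rw [pref_restrict hC R hx hy, pref_restrict hC R hy hx]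
  ext r
  rw [mem_ML_iff (A' ∪ B) R (margin (A' ∪ B) R) (fun _ _ _ _ => rfl)]
  have hmain := MLm_comp (A'.erase b) B b hbm.2 hd (margin (A' ∪ B) R)
    (fun x y => by unfold margin; ring)
    (fun x hx y hy => by
      have := pref_comp R hR hcomp (Finset.mem_union_left _ (Finset.mem_of_mem_erase hx))
        (Finset.disjoint_left.1 hd hx) hy hbm.2
      unfold margin
      rw [this.1, this.2]) r
  rw [hun, hins] at hmain
  rw [hmain]
  unfold compSet
  simp only [Set.mem_ofPred_eq, mem_ML_iff A' _ _ (hmr A' Finset.subset_union_left),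
    mem_ML_iff B _ _ (hmr B Finset.subset_union_right)]

end PSC
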